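/- Fix real constants m, a, κ, λ with c ≠ 0, m ≠ 0, a + 2m − 1 ≠ 0, and suppose the compatibility condition κ/(2m) = λ/(2c(a+2m−1)) holds. Let I ⊆ ℝ be a nonempty open interval such that τ > 0, τ − c > 0 and τ − 2c > 0 for every τ ∈ I, and let φ : I → ℝ be twice continuously differentiable and satisfy both (S1) and (S2) at every point of I. Then there exists a real constant C₂ such that φ(τ) = κ/(2m) + C₂·(τ−2c)^{1−a}·(τ−c)^{−m}·τ^{2m−1+a} for every τ ∈ I. -/

import Mathlib

/-- ψ(τ) = (τ−2c)^{1−a}·(τ−c)^{−m}·τ^{2m−1+a}, with real powers. -/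
noncomputable def psiFun (m a c : ℝ) : ℝ → ℝ := fun τ =>
  (τ - 2*c) ^ (1 - a) * (τ - c) ^ (-m) * τ ^ (2*m - 1 + a)

theorem psiFun_pos (m a : ℝ) {c τ : ℝ} (h0 : 0 < τ) (h1 : 0 < τ - c) (h2 : 0 < τ - 2*c) :
    0 < psiFun m a c τ := by
  unfold psiFun
  positivity

/-- The logarithmic derivative of `psiFun` at a point where all three bases are positive. -/
theorem hasDerivAt_psiFun (m a : ℝ) {c τ : ℝ} (h0 : 0 < τ) (h1 : 0 < τ - c)
    (h2 : 0 < τ - 2*c) :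
    HasDerivAt (psiFun m a c)
      (psiFun m a c τ * ((1 - a)/(τ - 2*c) - m/(τ - c) + (2*m - 1 + a)/τ)) τ := by
  have d2 := ((hasDerivAt_id τ).sub_const (2*c)).rpow_const (p := 1 - a) (Or.inl h2.ne')
  have d1 := ((hasDerivAt_id τ).sub_const c).rpow_const (p := -m) (Or.inl h1.ne')
  have d0 := (hasDerivAt_id τ).rpow_const (p := 2*m - 1 + a) (Or.inl h0.ne')
  refine ((d2.mul d1).mul d0).congr_deriv ?_
  simp only [id, psiFun, Pi.mul_apply, Real.rpow_sub_one h2.ne', Real.rpow_sub_one h1.ne',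
    Real.rpow_sub_one h0.ne']
  field_simp
  ring

/-- A function with the same logarithmic derivative as a nonvanishing `ψ` on an open
interval is a constant multiple of `ψ` there. -/
theorem exists_eq_const_mul_of_hasDerivAt {I : Set ℝ} (hI : IsOpen I) (hconn : I.OrdConnected)
    {u ψ L : ℝ → ℝ} (hu : ∀ τ ∈ I, HasDerivAt u (u τ * L τ) τ)
    (hψ : ∀ τ ∈ I, HasDerivAt ψ (ψ τ * L τ) τ) (hne : ∀ τ ∈ I, ψ τ ≠ 0) :
    ∃ C : ℝ, ∀ τ ∈ I, u τ = C * ψ τ := by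
  have hd : ∀ τ ∈ I, HasDerivAt (fun t => u t / ψ t) 0 τ := fun τ hτ =>
    ((hu τ hτ).div (hψ τ hτ) (hne τ hτ)).congr_deriv (by ring)
  obtain ⟨C, hC⟩ := hI.exists_is_const_of_deriv_eq_zero hconn.isPreconnected
    (fun τ hτ => (hd τ hτ).differentiableAt.differentiableWithinAt)
    (fun τ hτ => (hd τ hτ).deriv)
  exact ⟨C, fun τ hτ => (div_eq_iff (hne τ hτ)).mp (hC τ hτ)⟩

/-- Under the compatibility condition κ/(2m) = λ/(2c(a+2m−1)), every C² solution
of the system (S1)–(S2) on an interval where τ, τ−c and τ−2c are positive has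
the form φ = κ/(2m) + C₂ψ. -/
theorem general_solution_form
    (m a c κ lam : ℝ) (hc : c ≠ 0) (hm : m ≠ 0) (hconst : a + 2*m - 1 ≠ 0)
    (hcompat : κ/(2*m) = lam/(2*c*(a+2*m-1)))
    (I : Set ℝ) (hIopen : IsOpen I) (hIconn : I.OrdConnected) (hIne : I.Nonempty)
    (hpos : ∀ τ ∈ I, 0 < τ ∧ 0 < τ - c ∧ 0 < τ - 2*c)
    (φ : ℝ → ℝ) (hφ : ContDiffOn ℝ 2 φ I)
    (hS1 : ∀ τ ∈ I,
      τ*(τ-c)^2*(2*c-τ) * deriv (deriv φ) τ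
        + ((m-2)*τ^3 + c*(8-5*m-2*a)*τ^2 + 2*c^2*(2*a+4*m-5)*τ
            - 2*c^3*(2*m-2+a)) * deriv φ τ
        + m*τ*(τ-2*c) * φ τ = κ*τ*(τ-2*c)/2)
    (hS2 : ∀ τ ∈ I,
      τ^2*(τ-c)*(2*c-τ) * deriv (deriv φ) τ
        + ((m-1)*τ^3 + 2*c*(1-2*m-a)*τ^2 + 2*c^2*(a+2*m)*τ) * deriv φ τ
        + 2*c*(a+2*m-1)*(τ-2*c) * φ τ = lam*(τ-2*c)) :
    ∃ C₂ : ℝ, ∀ τ ∈ I, φ τ = κ/(2*m) + C₂ * psiFun m a c τ := by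
  obtain ⟨k, hk⟩ : ∃ k, k = κ/(2*m) := ⟨_, rfl⟩
  have hκ : κ = 2*m*k := by rw [hk]; field_simp
  have hlam : lam = 2*c*(a+2*m-1)*k := by rw [hk, hcompat]; field_simp
  rw [← hk]
  have hu : ∀ τ ∈ I, HasDerivAt (fun t => φ t - k)
      ((φ τ - k) * ((1 - a)/(τ - 2*c) - m/(τ - c) + (2*m - 1 + a)/τ)) τ := by
    intro τ hτ
    obtain ⟨h0, h1, h2⟩ := hpos τ hτ
    have hd : HasDerivAt φ (deriv φ τ) τ :=
      ((hφ.contDiffAt (hIopen.mem_nhds hτ)).differentiableAt (by norm_num)).hasDerivAt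
    refine (hd.sub_const k).congr_deriv ?_
    -- `τ·(S1) − (τ−c)·(S2)` is free of the second derivative and divisible by `τ − 2c`.
    have hfirst : τ*(τ-c)*(τ-2*c) * deriv φ τ
        = (m*τ^2 - 2*c*(a+2*m-1)*(τ-c)) * (φ τ - k) := by
      have e1 := hS1 τ hτ
      have e2 := hS2 τ hτ
      rw [hκ] at e1
      rw [hlam] at e2
      apply mul_left_cancel₀ h2.ne'
      linear_combination (τ - c) * e2 - τ * e1
    have h0' := h0.ne'
    have h1' := h1.ne'
    have h2' := h2.ne'
    field_simp
    linear_combination hfirst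
  obtain ⟨C, hC⟩ := exists_eq_const_mul_of_hasDerivAt hIopen hIconn hu
    (fun τ hτ => hasDerivAt_psiFun m a (hpos τ hτ).1 (hpos τ hτ).2.1 (hpos τ hτ).2.2)
    (fun τ hτ => (psiFun_pos m a (hpos τ hτ).1 (hpos τ hτ).2.1 (hpos τ hτ).2.2).ne')
  exact ⟨C, fun τ hτ => by linarith [hC τ hτ]⟩
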